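/- arXiv:2411.15884 — 2 statements merged into one kernel-verified Lean document; each statement's English description precedes it below -/
import Mathlib

section
/- Suppose n is odd and (A,B) is a symmetric near-factorization of the cyclic group Z_{2n}. Let (A',B') be the image of (A,B) under the Pêcher transform, i.e., A' = {a^{x mod 2} b^{x mod n} : x ∈ A} and B' = {a^{x mod 2} b^{x mod n} : x ∈ B} in the dihedral group D_n. Then (A',B') is a strongly symmetric near-factorization of D_n. -/
open Pointwise

/-- The Pêcher transform sends `x ∈ Z_{2n}` to `a^{x mod 2} b^{x mod n} ∈ D_n`,
i.e. to the rotation `b^{x mod n}` if `x` is even and to the reflection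
`a b^{x mod n}` if `x` is odd. -/
def pecher (n : ℕ) (x : ZMod (2 * n)) : DihedralGroup n :=
  if x.val % 2 = 0 then DihedralGroup.r (x.val : ZMod n)
  else DihedralGroup.sr (x.val : ZMod n)

/-- A subset `X` of `D_n` is strongly symmetric if `a^i b^j ∈ X ↔ a^i b^{-j} ∈ X`. -/
def StronglySymmetric {n : ℕ} (X : Finset (DihedralGroup n)) : Prop :=
  ∀ j : ZMod n, (DihedralGroup.r j ∈ X ↔ DihedralGroup.r (-j) ∈ X) ∧
    (DihedralGroup.sr j ∈ X ↔ DihedralGroup.sr (-j) ∈ X)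

/-- Reduction modulo `2`. -/
def redTwo (n : ℕ) : ZMod (2 * n) →+* ZMod 2 := ZMod.castHom (Dvd.intro n rfl) (ZMod 2)

/-- Reduction modulo `n`. -/
def redN (n : ℕ) : ZMod (2 * n) →+* ZMod n := ZMod.castHom (Dvd.intro_left 2 rfl) (ZMod n)

theorem redTwo_eq (n : ℕ) [NeZero n] (x : ZMod (2 * n)) : redTwo n x = (x.val : ZMod 2) := by
  conv_lhs => rw [← ZMod.natCast_zmod_val x]
  exact map_natCast _ _

theorem redN_eq (n : ℕ) [NeZero n] (x : ZMod (2 * n)) : redN n x = (x.val : ZMod n) := by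
  conv_lhs => rw [← ZMod.natCast_zmod_val x]
  exact map_natCast _ _

theorem pecher_eq (n : ℕ) [NeZero n] (x : ZMod (2 * n)) :
    pecher n x = if redTwo n x = 0 then DihedralGroup.r (redN n x)
      else DihedralGroup.sr (redN n x) := by
  rw [redTwo_eq, redN_eq, pecher]
  simp only [ZMod.natCast_eq_zero_iff, Nat.dvd_iff_mod_eq_zero]

theorem zmod_two_cases (u : ZMod 2) : u = 0 ∨ u = 1 := by
  revert u; decide

theorem pecher_inj (n : ℕ) [NeZero n] (hodd : Odd n) : Function.Injective (pecher n) := by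
  intro x y h
  have key : redTwo n x = redTwo n y ∧ redN n x = redN n y := by
    rw [pecher_eq, pecher_eq] at h
    rcases zmod_two_cases (redTwo n x) with hx | hx <;>
      rcases zmod_two_cases (redTwo n y) with hy | hy <;> simp_all
  obtain ⟨h2, hn⟩ := key
  rw [redTwo_eq, redTwo_eq, ZMod.natCast_eq_natCast_iff] at h2
  rw [redN_eq, redN_eq, ZMod.natCast_eq_natCast_iff] at hn
  have hc : Nat.Coprime 2 n := Nat.coprime_two_left.mpr hodd
  have := (Nat.modEq_and_modEq_iff_modEq_mul hc).mp ⟨h2, hn⟩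
  rw [← ZMod.natCast_eq_natCast_iff, ZMod.natCast_zmod_val, ZMod.natCast_zmod_val] at this
  exact this

theorem pecher_bij (n : ℕ) [NeZero n] (hodd : Odd n) : Function.Bijective (pecher n) := by
  rw [Fintype.bijective_iff_injective_and_card]
  exact ⟨pecher_inj n hodd, by rw [ZMod.card, DihedralGroup.card]⟩

theorem pecher_mul (n : ℕ) [NeZero n] (x y : ZMod (2 * n)) :
    pecher n x * pecher n y =
      if redTwo n y = 0 then pecher n (x + y) else pecher n (-x + y) := by
  simp only [pecher_eq, map_add, map_neg]
  have h11 : (1 : ZMod 2) + 1 = 0 := by decide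
  rcases zmod_two_cases (redTwo n x) with hx | hx <;>
    rcases zmod_two_cases (redTwo n y) with hy | hy <;> simp [hx, hy, h11, sub_eq_neg_add]

theorem strong_of_symm (n : ℕ) [NeZero n] (A : Finset (ZMod (2 * n))) (hA : A = -A) :
    StronglySymmetric (A.image (pecher n)) := by
  have hm : ∀ x ∈ A, -x ∈ A := by
    intro x hx
    rw [hA]; simpa using hx
  have hr : ∀ j : ZMod n, DihedralGroup.r j ∈ A.image (pecher n) →
      DihedralGroup.r (-j) ∈ A.image (pecher n) := by
    intro j hj
    obtain ⟨x, hx, he⟩ := Finset.mem_image.mp hj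
    refine Finset.mem_image.mpr ⟨-x, hm x hx, ?_⟩
    rw [pecher_eq] at he ⊢
    rw [map_neg, map_neg]
    clear hA hj
    by_cases h0 : redTwo n x = 0 <;> simp_all
  have hs : ∀ j : ZMod n, DihedralGroup.sr j ∈ A.image (pecher n) →
      DihedralGroup.sr (-j) ∈ A.image (pecher n) := by
    intro j hj
    obtain ⟨x, hx, he⟩ := Finset.mem_image.mp hj
    refine Finset.mem_image.mpr ⟨-x, hm x hx, ?_⟩
    rw [pecher_eq] at he ⊢
    rw [map_neg, map_neg]
    clear hA hj
    by_cases h0 : redTwo n x = 0 <;> simp_all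
  intro j
  exact ⟨⟨hr j, fun h => by simpa using hr _ h⟩, ⟨hs j, fun h => by simpa using hs _ h⟩⟩

/-- If `(A,B)` is a symmetric near-factorization of `Z_{2n}` with `n` odd, then
its image `(A',B')` under the Pêcher transform is a strongly symmetric
near-factorization of `D_n`. -/
theorem stmt9 (n : ℕ) [NeZero n] (hodd : Odd n)
    (A B : Finset (ZMod (2 * n)))
    (hNF : A.card * B.card = 2 * n - 1 ∧ A + B = Finset.univ \ {0})
    (hsymA : A = -A) (hsymB : B = -B) :
    ((A.image (pecher n)).card * (B.image (pecher n)).card = 2 * n - 1 ∧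
      (A.image (pecher n)) * (B.image (pecher n)) = Finset.univ \ {1}) ∧
    StronglySymmetric (A.image (pecher n)) ∧ StronglySymmetric (B.image (pecher n)) := by
  have hinj := pecher_inj n hodd
  have hm : ∀ x ∈ A, -x ∈ A := by
    intro x hx
    rw [hsymA]; simpa using hx
  refine ⟨⟨?_, ?_⟩, strong_of_symm n A hsymA, strong_of_symm n B hsymB⟩
  · rw [Finset.card_image_of_injective _ hinj, Finset.card_image_of_injective _ hinj]
    exact hNF.1
  · have hone : pecher n 0 = 1 := by
      rw [pecher_eq]; simp
    have hprod : A.image (pecher n) * B.image (pecher n) = (A + B).image (pecher n) := by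
      ext g
      simp only [Finset.mem_mul, Finset.mem_image, Finset.mem_add]
      constructor
      · rintro ⟨_, ⟨x, hx, rfl⟩, _, ⟨y, hy, rfl⟩, rfl⟩
        rw [pecher_mul]
        split_ifs with h
        · exact ⟨x + y, ⟨x, hx, y, hy, rfl⟩, rfl⟩
        · exact ⟨-x + y, ⟨-x, hm x hx, y, hy, rfl⟩, rfl⟩
      · rintro ⟨_, ⟨x, hx, y, hy, rfl⟩, rfl⟩
        by_cases h : redTwo n y = 0
        · exact ⟨_, ⟨x, hx, rfl⟩, _, ⟨y, hy, rfl⟩, by rw [pecher_mul, if_pos h]⟩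
        · exact ⟨_, ⟨-x, hm x hx, rfl⟩, _, ⟨y, hy, rfl⟩, by
            rw [pecher_mul, if_neg h, neg_neg]⟩
    rw [hprod, hNF.2, Finset.image_sdiff _ _ hinj, Finset.image_singleton, hone,
      Finset.image_univ_of_surjective (pecher_bij n hodd).surjective]
end

section
/- Suppose k is odd and n = (k² + 1)/2. Suppose (A',B') and (C',D') are equivalent strongly symmetric (k,k)-near-factorizations of D_n with C' = f_{i,j}(A')h and D' = h⁻¹ f_{i,j}(B'). Let (A,B) and (C,D) be obtained from (A',B') and (C',D') by applying the inverse Pêcher transform. Then (A,B) and (C,D) are equivalent symmetric near-factorizations of Z_{2n}. -/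
open Pointwise

/-- The inverse Pêcher transform of a subset `X'` of `D_n`: the set of all
`x ∈ Z_{2n}` with `a^{x mod 2} b^{x mod n} ∈ X'`. -/
def ipecher (n : ℕ) [NeZero n] (X' : Finset (DihedralGroup n)) :
    Finset (ZMod (2 * n)) :=
  Finset.univ.filter (fun x => pecher n x ∈ X')

/-- The automorphism `f_{i,j}` of `D_n`, acting by `b^h ↦ b^{i·h}` and
`a·b^h ↦ a·b^{j + i·h}`. -/
def fij (n : ℕ) (i j : ℕ) : DihedralGroup n → DihedralGroup n
  | DihedralGroup.r h => DihedralGroup.r ((i : ZMod n) * h)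
  | DihedralGroup.sr h => DihedralGroup.sr ((j : ZMod n) + (i : ZMod n) * h)

namespace PecherAux

open DihedralGroup

/-- reduction mod `n` -/
def q (n : ℕ) : ZMod (2 * n) →+* ZMod n := ZMod.castHom (Dvd.intro_left 2 rfl) (ZMod n)

/-- reduction mod `2` -/
def p (n : ℕ) : ZMod (2 * n) →+* ZMod 2 := ZMod.castHom (Dvd.intro n rfl) (ZMod 2)

lemma pecher_eq (n : ℕ) [NeZero n] (x : ZMod (2 * n)) :
    pecher n x = if p n x = 0 then r (q n x) else sr (q n x) := by
  have h1 : ((x.val : ℕ) : ZMod n) = q n x := by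
    rw [ZMod.natCast_val]; rfl
  have h2 : ((x.val : ℕ) : ZMod 2) = p n x := by
    rw [ZMod.natCast_val]; rfl
  have h3 : (x.val % 2 = 0) ↔ p n x = 0 := by
    rw [← h2, ZMod.natCast_eq_zero_iff]; omega
  unfold pecher
  rw [h1]
  simp only [h3]

lemma pq_inj (n : ℕ) [NeZero n] (hn : Odd n) (x y : ZMod (2 * n)) (h1 : p n x = p n y)
    (h2 : q n x = q n y) : x = y := by
  rw [← sub_eq_zero] at h1 h2 ⊢
  rw [← map_sub] at h1 h2
  generalize x - y = z at *
  have e1 : ((z.val : ℕ) : ZMod n) = q n z := by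
    rw [ZMod.natCast_val]; rfl
  have e2 : ((z.val : ℕ) : ZMod 2) = p n z := by
    rw [ZMod.natCast_val]; rfl
  rw [← e1, ZMod.natCast_eq_zero_iff] at h2
  rw [← e2, ZMod.natCast_eq_zero_iff] at h1
  have h3 : 2 * n ∣ z.val :=
    Nat.Coprime.mul_dvd_of_dvd_of_dvd (Nat.coprime_two_left.mpr hn) h1 h2
  have h4 := (ZMod.natCast_eq_zero_iff z.val (2 * n)).mpr h3
  rwa [ZMod.natCast_zmod_val] at h4

lemma zmod2 (a : ZMod 2) : a = 0 ∨ a = 1 := by revert a; decide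

lemma pecher_inj (n : ℕ) [NeZero n] (hn : Odd n) : Function.Injective (pecher n) := by
  intro x y h
  rw [pecher_eq, pecher_eq] at h
  rcases zmod2 (p n x) with hx | hx <;> rcases zmod2 (p n y) with hy | hy <;>
    simp [hx, hy] at h <;> exact pq_inj n hn x y (by rw [hx, hy]) h

lemma pecher_bij (n : ℕ) [NeZero n] (hn : Odd n) : Function.Bijective (pecher n) := by
  rw [Fintype.bijective_iff_injective_and_card]
  refine ⟨pecher_inj n hn, ?_⟩
  rw [ZMod.card, DihedralGroup.card]

lemma mem_ip (n : ℕ) [NeZero n] (X : Finset (DihedralGroup n)) (x : ZMod (2 * n)) :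
    x ∈ ipecher n X ↔ pecher n x ∈ X := by simp [ipecher]

lemma card_ip (n : ℕ) [NeZero n] (hn : Odd n) (X : Finset (DihedralGroup n)) :
    (ipecher n X).card = X.card := by
  apply Finset.card_bij (fun x _ => pecher n x)
  · intro x hx; exact (mem_ip n X x).1 hx
  · intro x _ y _ h; exact pecher_inj n hn h
  · intro b hb
    obtain ⟨x, rfl⟩ := (pecher_bij n hn).2 b
    exact ⟨x, (mem_ip n X x).2 hb, rfl⟩

lemma pecher_neg_mem (n : ℕ) [NeZero n] (X : Finset (DihedralGroup n))
    (hX : StronglySymmetric X) (x : ZMod (2 * n)) : pecher n (-x) ∈ X ↔ pecher n x ∈ X := by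
  rw [pecher_eq, pecher_eq]
  have := hX (q n x)
  rcases zmod2 (p n x) with hx | hx <;> simp [hx, this.1, this.2]

lemma ip_symm (n : ℕ) [NeZero n] (X : Finset (DihedralGroup n))
    (hX : StronglySymmetric X) : ipecher n X = -(ipecher n X) := by
  ext x
  rw [Finset.mem_neg', mem_ip, mem_ip, pecher_neg_mem n X hX]

lemma pecher_add (n : ℕ) [NeZero n] (x y : ZMod (2 * n)) :
    pecher n (x + y) = pecher n (if p n y = 0 then x else -x) * pecher n y := by
  have h11 : (1 : ZMod 2) + 1 = 0 := by decide
  rw [pecher_eq, pecher_eq, pecher_eq]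
  rcases zmod2 (p n x) with hx | hx <;> rcases zmod2 (p n y) with hy | hy <;>
    simp [hx, hy, h11, add_comm]

lemma ip_nf (n : ℕ) [NeZero n] (hn : Odd n) (A B : Finset (DihedralGroup n))
    (hA : StronglySymmetric A) (hAB : A * B = Finset.univ \ {1}) :
    ipecher n A + ipecher n B = Finset.univ \ {0} := by
  have key : ∀ z, z ∈ ipecher n A + ipecher n B ↔ pecher n z ∈ A * B := by
    intro z
    rw [Finset.mem_add, Finset.mem_mul]
    constructor
    · rintro ⟨x, hx, y, hy, rfl⟩
      rw [mem_ip] at hx hy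
      refine ⟨_, ?_, _, hy, (pecher_add n x y).symm⟩
      split_ifs
      · exact hx
      · exact (pecher_neg_mem n A hA x).2 hx
    · rintro ⟨a, ha, b, hb, hab⟩
      obtain ⟨x, rfl⟩ := (pecher_bij n hn).2 a
      obtain ⟨y, rfl⟩ := (pecher_bij n hn).2 b
      refine ⟨if p n y = 0 then x else -x, ?_, y, (mem_ip _ _ _).2 hb, ?_⟩
      · rw [mem_ip]
        split_ifs
        · exact ha
        · exact (pecher_neg_mem n A hA x).2 ha
      · apply pecher_inj n hn
        rw [pecher_add, ← hab]
        split_ifs <;> simp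
  have h0 : pecher n 0 = 1 := by rw [pecher_eq]; simp
  ext z
  rw [key, hAB]
  simp only [Finset.mem_sdiff, Finset.mem_univ, Finset.mem_singleton, true_and]
  rw [← h0, (pecher_inj n hn).eq_iff]

lemma uniq {n : ℕ} [NeZero n] {A B : Finset (DihedralGroup n)}
    (hNF : A.card * B.card = 2 * n - 1 ∧ A * B = Finset.univ \ {1}) :
    Set.InjOn (fun x : DihedralGroup n × DihedralGroup n => x.1 * x.2)
      ((A : Set (DihedralGroup n)) ×ˢ (B : Set (DihedralGroup n))) := by
  rw [← Finset.card_mul_iff, hNF.1, hNF.2, Finset.card_sdiff_of_subset (by simp), Finset.card_univ,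
    DihedralGroup.card, Finset.card_singleton]

/-- the reflections -/
def refl (n : ℕ) [NeZero n] : Finset (DihedralGroup n) := Finset.univ.image sr

lemma mem_refl {n : ℕ} [NeZero n] (g : DihedralGroup n) : g ∈ refl n ↔ ∃ x, g = sr x := by
  simp [refl, eq_comm]

lemma refl_card (n : ℕ) [NeZero n] : (refl n).card = n := by
  unfold refl
  rw [Finset.card_image_of_injective _ (fun a b h => by simpa using h), Finset.card_univ, ZMod.card]

lemma card_eq {n : ℕ} [NeZero n] {A B : Finset (DihedralGroup n)}
    (hNF : A.card * B.card = 2 * n - 1 ∧ A * B = Finset.univ \ {1})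
    (S T : Finset (DihedralGroup n)) (hS : S ⊆ A) (hT : T ⊆ B)
    (h1 : ∀ s ∈ S, ∀ t ∈ T, s * t ∈ refl n)
    (h2 : ∀ s ∈ A, ∀ t ∈ B, s * t ∈ refl n → s ∈ S ∧ t ∈ T) : S.card * T.card = n := by
  have hst : S * T = refl n := by
    ext g
    constructor
    · rw [Finset.mem_mul]
      rintro ⟨s, hs, t, ht, rfl⟩
      exact h1 s hs t ht
    · intro hg
      have : g ∈ A * B := by
        obtain ⟨x, rfl⟩ := (mem_refl g).1 hg
        rw [hNF.2]
        simp only [Finset.mem_sdiff, Finset.mem_univ, Finset.mem_singleton, true_and, one_def]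
        exact fun h => nomatch h
      obtain ⟨s, hs, t, ht, rfl⟩ := Finset.mem_mul.1 this
      obtain ⟨h3, h4⟩ := h2 s hs t ht hg
      exact Finset.mul_mem_mul h3 h4
  refine Eq.trans (Eq.symm ?_) (refl_card n)
  rw [← hst, Finset.card_mul_iff]
  exact (uniq hNF).mono (Set.prod_mono (by exact_mod_cast hS) (by exact_mod_cast hT))

lemma k_one {n k m : ℕ} (hnk : 2 * n = k ^ 2 + 1) (h : k * m = n) : n = 1 := by
  have h1 : k ∣ k ^ 2 + 1 := by rw [← hnk, ← h]; exact ⟨2 * m, by ring⟩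
  have h2 : k ∣ 1 := (Nat.dvd_add_right (dvd_pow_self k two_ne_zero)).1 h1
  have h3 : k = 1 := Nat.dvd_one.1 h2
  subst h3; omega

lemma nonempties {n k : ℕ} [NeZero n] (hnk : 2 * n = k ^ 2 + 1) (hn1 : n ≠ 1)
    {A B : Finset (DihedralGroup n)} (hA : A.card = k) (hB : B.card = k)
    (hNF : A.card * B.card = 2 * n - 1 ∧ A * B = Finset.univ \ {1}) :
    (∃ x, r x ∈ A) ∧ (∃ x, sr x ∈ A) ∧ (∃ x, r x ∈ B) ∧ (∃ x, sr x ∈ B) := by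
  classical
  refine ⟨?_, ?_, ?_, ?_⟩ <;> by_contra! hcon <;> apply hn1
  · have := card_eq hNF A (B.filter (fun g => g ∉ refl n)) (subset_refl _)
      (Finset.filter_subset _ _)
      (by rintro (s | s) hs (t | t) ht <;> simp_all [mem_refl])
      (by rintro (s | s) hs (t | t) ht <;> simp_all [mem_refl])
    rw [hA] at this
    exact k_one hnk this
  · have := card_eq hNF A (B.filter (fun g => g ∈ refl n)) (subset_refl _)
      (Finset.filter_subset _ _)
      (by rintro (s | s) hs (t | t) ht <;> simp_all [mem_refl])
      (by rintro (s | s) hs (t | t) ht <;> simp_all [mem_refl])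
    rw [hA] at this
    exact k_one hnk this
  · have := card_eq hNF (A.filter (fun g => g ∉ refl n)) B
      (Finset.filter_subset _ _) (subset_refl _)
      (by rintro (s | s) hs (t | t) ht <;> simp_all [mem_refl])
      (by rintro (s | s) hs (t | t) ht <;> simp_all [mem_refl])
    rw [hB, mul_comm] at this
    exact k_one hnk this
  · have := card_eq hNF (A.filter (fun g => g ∈ refl n)) B
      (Finset.filter_subset _ _) (subset_refl _)
      (by rintro (s | s) hs (t | t) ht <;> simp_all [mem_refl])
      (by rintro (s | s) hs (t | t) ht <;> simp_all [mem_refl])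
    rw [hB, mul_comm] at this
    exact k_one hnk this

lemma noinv {n k : ℕ} [NeZero n] (hnk : 2 * n = k ^ 2 + 1)
    {A B : Finset (DihedralGroup n)} (hA : A.card = k) (hB : B.card = k)
    (hNF : A.card * B.card = 2 * n - 1 ∧ A * B = Finset.univ \ {1}) (u : ZMod n)
    (h : ((∀ x, r x ∈ A → r (x + u) ∈ A) ∧ (∀ x, r x ∈ B → r (x + u) ∈ B)) ∨
      ((∀ x, sr x ∈ A → sr (x + u) ∈ A) ∧ (∀ x, sr x ∈ B → sr (x + u) ∈ B))) : u = 0 := by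
  by_cases hn1 : n = 1
  · subst hn1; exact Subsingleton.elim _ _
  obtain ⟨⟨a, ha⟩, ⟨a', ha'⟩, ⟨b, hb⟩, ⟨b', hb'⟩⟩ := nonempties hnk hn1 hA hB hNF
  have hu := uniq hNF
  rcases h with ⟨h1, h2⟩ | ⟨h1, h2⟩
  · have := @hu (r (a + u), r b) ⟨h1 a ha, hb⟩ (r a, r (b + u)) ⟨ha, h2 b hb⟩
      (by simp; ring)
    simpa using this
  · have := @hu (sr (a' + u), sr (b' + u)) ⟨h1 a' ha', h2 b' hb'⟩ (sr a', sr b') ⟨ha', hb'⟩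
      (by simp)
    simpa using this

lemma shift {n : ℕ} {P Q : ZMod n → Prop} (hP : ∀ x, P x ↔ P (-x)) (hQ : ∀ x, Q x ↔ Q (-x))
    (i w t : ZMod n) (hw : w * i = 1) (h : ∀ z, Q z ↔ P (w * (z - t))) :
    (∀ x, P x → P (x + 2 * w * t)) ∧ (∀ x, P x → P (x + 2 * w * (-t))) := by
  have h1 : ∀ x, P x → P (x + 2 * w * t) := by
    intro x hx
    have h2 : Q (i * x + t) := by
      rw [h]; convert hx using 1; linear_combination x * hw
    rw [hQ, h, hP] at h2
    convert h2 using 1; linear_combination (-x) * hw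
  refine ⟨h1, fun x hx => ?_⟩
  have := h1 _ ((hP x).1 hx)
  rw [hP] at this
  convert this using 1; ring

lemma image_iff (n : ℕ) [NeZero n] (A C : Finset (DihedralGroup n)) (u s h₀ : ZMod (2 * n))
    (hus : s * u = 1) (h : ∀ z, pecher n z ∈ C ↔ pecher n (s * (z - h₀)) ∈ A) :
    ipecher n C = (ipecher n A).image (fun x => u * x + h₀) := by
  ext z
  rw [mem_ip, h, Finset.mem_image]
  constructor
  · intro hz
    exact ⟨_, (mem_ip _ _ _).2 hz, by linear_combination (z - h₀) * hus⟩
  · rintro ⟨x, hx, rfl⟩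
    rw [mem_ip] at hx
    convert hx using 2
    linear_combination x * hus

lemma p_unit (n : ℕ) (u s : ZMod (2 * n)) (hus : s * u = 1) : p n s = 1 := by
  have := congrArg (p n) hus
  rw [map_mul, map_one] at this
  rcases zmod2 (p n s) with h | h
  · simp [h] at this
  · exact h

lemma eqv0 (n : ℕ) [NeZero n] (A C : Finset (DihedralGroup n)) (u s : ZMod (2 * n))
    (hus : s * u = 1) (h1 : ∀ z, r z ∈ C ↔ r (q n s * z) ∈ A)
    (h2 : ∀ z, sr z ∈ C ↔ sr (q n s * z) ∈ A) :
    ∀ z, pecher n z ∈ C ↔ pecher n (s * (z - 0)) ∈ A := by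
  intro z
  have hs := p_unit n u s hus
  rw [pecher_eq, pecher_eq]
  rcases zmod2 (p n z) with hz | hz <;> simp [hz, hs, h1, h2]

lemma eqv1 (n : ℕ) [NeZero n] (A C : Finset (DihedralGroup n)) (u s h₀ : ZMod (2 * n))
    (hh : p n h₀ = 1) (hq : q n h₀ = 0)
    (hus : s * u = 1) (h1 : ∀ z, r z ∈ C ↔ sr (q n s * z) ∈ A)
    (h2 : ∀ z, sr z ∈ C ↔ r (q n s * z) ∈ A) :
    ∀ z, pecher n z ∈ C ↔ pecher n (s * (z - h₀)) ∈ A := by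
  intro z
  have hs := p_unit n u s hus
  rw [pecher_eq, pecher_eq]
  rcases zmod2 (p n z) with hz | hz <;> simp [hz, hs, h1, h2, hh, hq]

/-- `f_{i,j}` is multiplicative. -/
lemma fij_mul (n i j : ℕ) (x y : DihedralGroup n) :
    fij n i j (x * y) = fij n i j x * fij n i j y := by
  rcases x with x | x <;> rcases y with y | y <;> simp [fij] <;> ring

lemma fij_bij (n i j : ℕ) [NeZero n] (w : ZMod n) (hw : w * i = 1) :
    Function.Bijective (fij n i j) := by
  rw [← Finite.injective_iff_bijective]
  have key : ∀ a b : ZMod n, (i : ZMod n) * a = i * b → a = b := by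
    intro a b h
    linear_combination w * h + (b - a) * hw
  rintro (x | x) (y | y) h <;> simp [fij] at h
  · rw [key _ _ h]
  · rw [key _ _ h]

end PecherAux


/-- Suppose `k` is odd and `n = (k² + 1)/2`. If `(A',B')` and
`(C',D') = (f_{i,j}(A')h, h⁻¹f_{i,j}(B'))` are equivalent strongly symmetric
`(k,k)`-near-factorizations of `D_n`, then their images `(A,B)` and `(C,D)`
under the inverse Pêcher transform are equivalent symmetric
near-factorizations of `Z_{2n}`. -/
theorem stmt17 (n : ℕ) [NeZero n] (k : ℕ) (hkodd : Odd k) (hnk : 2 * n = k ^ 2 + 1)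
    (A' B' : Finset (DihedralGroup n))
    (hA'card : A'.card = k) (hB'card : B'.card = k)
    (hNF : A'.card * B'.card = 2 * n - 1 ∧ A' * B' = Finset.univ \ {1})
    (hssA : StronglySymmetric A') (hssB : StronglySymmetric B')
    (i j : ℕ) (hi : Nat.gcd i n = 1) (hj : j < n)
    (h : DihedralGroup n)
    (C' D' : Finset (DihedralGroup n))
    (hC' : C' = (A'.image (fij n i j)).image (· * h))
    (hD' : D' = (B'.image (fij n i j)).image (h⁻¹ * ·))
    (hssC : StronglySymmetric C') (hssD : StronglySymmetric D') :
    ((ipecher n A').card * (ipecher n B').card = 2 * n - 1 ∧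
      ipecher n A' + ipecher n B' = Finset.univ \ {0}) ∧
    ipecher n A' = -(ipecher n A') ∧ ipecher n B' = -(ipecher n B') ∧
    ((ipecher n C').card * (ipecher n D').card = 2 * n - 1 ∧
      ipecher n C' + ipecher n D' = Finset.univ \ {0}) ∧
    ipecher n C' = -(ipecher n C') ∧ ipecher n D' = -(ipecher n D') ∧
    ∃ (r h₀ : ℤ), Int.gcd r (2 * n) = 1 ∧
      ipecher n C' = (ipecher n A').image
        (fun x => (r : ZMod (2 * n)) * x + (h₀ : ZMod (2 * n))) ∧
      ipecher n D' = (ipecher n B').image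
        (fun x => (r : ZMod (2 * n)) * x - (h₀ : ZMod (2 * n))) := by
  have hn : Odd n := by
    obtain ⟨m, rfl⟩ := hkodd
    exact ⟨m ^ 2 + m, by nlinarith⟩
  -- an odd representative of `i`
  obtain ⟨i', hi'odd, hi'⟩ : ∃ i' : ℕ, Nat.Coprime i' (2 * n) ∧ (i' : ZMod n) = i := by
    rcases Nat.even_or_odd i with he | ho
    · refine ⟨i + n, ?_, by simp⟩
      refine Nat.Coprime.mul_right (Nat.coprime_two_right.mpr (he.add_odd hn)) ?_
      simpa using hi
    · exact ⟨i, Nat.Coprime.mul_right (Nat.coprime_two_right.mpr ho) hi, rfl⟩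
  obtain ⟨s, hs⟩ : ∃ s : ZMod (2 * n), s * (i' : ZMod (2 * n)) = 1 :=
    ⟨(i' : ZMod (2 * n))⁻¹, (mul_comm _ _).trans (ZMod.coe_mul_inv_eq_one i' hi'odd)⟩
  have hw : PecherAux.q n s * (i : ZMod n) = 1 := by
    have := congrArg (PecherAux.q n) hs
    rwa [map_mul, map_one, map_natCast, hi'] at this
  have hbij := PecherAux.fij_bij n i j _ hw
  have hCcard : C'.card = k := by
    rw [hC', Finset.card_image_of_injective _ (mul_left_injective h),
      Finset.card_image_of_injective _ hbij.1, hA'card]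
  have hDcard : D'.card = k := by
    rw [hD', Finset.card_image_of_injective _ (mul_right_injective h⁻¹),
      Finset.card_image_of_injective _ hbij.1, hB'card]
  have hf1 : fij n i j 1 = 1 := by
    have := PecherAux.fij_mul n i j 1 1
    simpa using this
  have hCD : C' * D' = Finset.univ \ {1} := by
    ext g
    have hg : g ∈ C' * D' ↔ ∃ y, y ∈ A' * B' ∧ fij n i j y = g := by
      rw [Finset.mem_mul, hC', hD']
      constructor
      · simp only [Finset.mem_image]
        rintro ⟨_, ⟨_, ⟨a, ha, rfl⟩, rfl⟩, _, ⟨_, ⟨b, hb, rfl⟩, rfl⟩, rfl⟩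
        refine ⟨a * b, Finset.mul_mem_mul ha hb, ?_⟩
        rw [PecherAux.fij_mul]; group
      · rintro ⟨y, hy, rfl⟩
        obtain ⟨a, ha, b, hb, rfl⟩ := Finset.mem_mul.1 hy
        refine ⟨_, Finset.mem_image_of_mem _ (Finset.mem_image_of_mem _ ha), _,
          Finset.mem_image_of_mem _ (Finset.mem_image_of_mem _ hb), ?_⟩
        rw [PecherAux.fij_mul]; group
    rw [hg, hNF.2]
    simp only [Finset.mem_sdiff, Finset.mem_univ, Finset.mem_singleton, true_and]
    constructor
    · rintro ⟨y, hy, rfl⟩ h1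
      exact hy (hbij.1 (h1.trans hf1.symm))
    · intro h1
      obtain ⟨y, rfl⟩ := hbij.2 g
      exact ⟨y, fun h2 => h1 (by rw [h2, hf1]), rfl⟩
  have hkk : k * k = 2 * n - 1 := by rw [hnk, pow_two]; simp
  refine ⟨⟨?_, PecherAux.ip_nf n hn A' B' hssA hNF.2⟩, PecherAux.ip_symm n _ hssA,
    PecherAux.ip_symm n _ hssB, ⟨?_, PecherAux.ip_nf n hn C' D' hssC hCD⟩,
    PecherAux.ip_symm n _ hssC, PecherAux.ip_symm n _ hssD, ?_⟩
  · rw [PecherAux.card_ip n hn, PecherAux.card_ip n hn, hA'card, hB'card, hkk]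
  · rw [PecherAux.card_ip n hn, PecherAux.card_ip n hn, hCcard, hDcard, hkk]
  -- membership in `f(X)`
  set w := PecherAux.q n s with hwdef
  have memf_r : ∀ (X : Finset (DihedralGroup n)) (z : ZMod n),
      DihedralGroup.r z ∈ X.image (fij n i j) ↔ DihedralGroup.r (w * z) ∈ X := by
    intro X z
    have : DihedralGroup.r z = fij n i j (DihedralGroup.r (w * z)) := by
      simp only [fij]; congr 1; linear_combination (-z) * hw
    rw [this, hbij.1.mem_finset_image]
  have memf_sr : ∀ (X : Finset (DihedralGroup n)) (z : ZMod n),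
      DihedralGroup.sr z ∈ X.image (fij n i j) ↔ DihedralGroup.sr (w * (z - (j : ZMod n))) ∈ X := by
    intro X z
    have : DihedralGroup.sr z = fij n i j (DihedralGroup.sr (w * (z - (j : ZMod n)))) := by
      simp only [fij]; congr 1; linear_combination (-(z - (j : ZMod n))) * hw
    rw [this, hbij.1.mem_finset_image]
  have memC : ∀ g, g ∈ C' ↔ g * h⁻¹ ∈ A'.image (fij n i j) := by
    intro g
    have : g = (g * h⁻¹) * h := by group
    rw [hC']
    conv_lhs => rw [this]
    exact (mul_left_injective h).mem_finset_image
  have memD : ∀ g, g ∈ D' ↔ h * g ∈ B'.image (fij n i j) := by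
    intro g
    have : g = h⁻¹ * (h * g) := by group
    rw [hD']
    conv_lhs => rw [this]
    exact (mul_right_injective h⁻¹).mem_finset_image
  have h2unit : ∀ t : ZMod n, 2 * w * t = 0 → t = 0 := by
    intro t ht
    obtain ⟨m, hm⟩ := hn
    have h0 : ((2 * m + 1 : ℕ) : ZMod n) = 0 := by rw [← hm]; simp
    push_cast at h0
    linear_combination (-(m : ZMod n)) * i * ht + t * h0 + (2 * m * t) * hw
  have hnoinv := PecherAux.noinv hnk hA'card hB'card hNF
  rcases h with t | t
  · have C1 : ∀ z, DihedralGroup.r z ∈ C' ↔ DihedralGroup.r (w * (z - t)) ∈ A' := by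
      intro z
      rw [memC, DihedralGroup.inv_r, DihedralGroup.r_mul_r, memf_r, sub_eq_add_neg]
    have C2 : ∀ z, DihedralGroup.sr z ∈ C' ↔ DihedralGroup.sr (w * (z - (t + (j : ZMod n)))) ∈ A' := by
      intro z
      rw [memC, DihedralGroup.inv_r, DihedralGroup.sr_mul_r, memf_sr]
      ring_nf
    have D1 : ∀ z, DihedralGroup.r z ∈ D' ↔ DihedralGroup.r (w * (z - -t)) ∈ B' := by
      intro z
      rw [memD, DihedralGroup.r_mul_r, memf_r]
      ring_nf
    have D2 : ∀ z, DihedralGroup.sr z ∈ D' ↔ DihedralGroup.sr (w * (z - (t + (j : ZMod n)))) ∈ B' := by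
      intro z
      rw [memD, DihedralGroup.r_mul_sr, memf_sr]
      ring_nf
    have ht : t = 0 := h2unit _ (hnoinv _ (Or.inl
      ⟨(PecherAux.shift (fun x => (hssA x).1) (fun x => (hssC x).1) i w _ hw C1).1,
        by simpa using
          (PecherAux.shift (fun x => (hssB x).1) (fun x => (hssD x).1) i w _ hw D1).2⟩))
    have hj0 : t + (j : ZMod n) = 0 := h2unit _ (hnoinv _ (Or.inr
      ⟨(PecherAux.shift (fun x => (hssA x).2) (fun x => (hssC x).2) i w _ hw C2).1,
        (PecherAux.shift (fun x => (hssB x).2) (fun x => (hssD x).2) i w _ hw D2).1⟩))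
    rw [hj0] at C2 D2
    rw [ht] at C1 D1
    simp only [neg_zero, sub_zero] at C1 C2 D1 D2
    refine ⟨i', 0, by exact_mod_cast hi'odd, ?_, ?_⟩
    · have := PecherAux.image_iff n A' C' i' s 0 hs (PecherAux.eqv0 n A' C' i' s hs C1 C2)
      simpa using this
    · have := PecherAux.image_iff n B' D' i' s 0 hs (PecherAux.eqv0 n B' D' i' s hs D1 D2)
      simpa using this
  · have C1 : ∀ z, DihedralGroup.r z ∈ C' ↔ DihedralGroup.sr (w * ((-z) - ((j : ZMod n) - t))) ∈ A' := by
      intro z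
      rw [memC, DihedralGroup.inv_sr, DihedralGroup.r_mul_sr, memf_sr]
      ring_nf
    have C1' : ∀ z, DihedralGroup.r z ∈ C' ↔ DihedralGroup.sr (w * (z - ((j : ZMod n) - t))) ∈ A' := by
      intro z
      rw [(hssC z).1, C1, neg_neg]
    have C2 : ∀ z, DihedralGroup.sr z ∈ C' ↔ DihedralGroup.r (w * (z - t)) ∈ A' := by
      intro z
      rw [memC, DihedralGroup.inv_sr, DihedralGroup.sr_mul_sr, memf_r, (hssA _).1]
      ring_nf
    have D1 : ∀ z, DihedralGroup.r z ∈ D' ↔ DihedralGroup.sr (w * (z - ((j : ZMod n) - t))) ∈ B' := by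
      intro z
      rw [memD, DihedralGroup.sr_mul_r, memf_sr]
      ring_nf
    have D2 : ∀ z, DihedralGroup.sr z ∈ D' ↔ DihedralGroup.r (w * (z - t)) ∈ B' := by
      intro z
      rw [memD, DihedralGroup.sr_mul_sr, memf_r]
    have ht : t = 0 := h2unit _ (hnoinv _ (Or.inl
      ⟨(PecherAux.shift (fun x => (hssA x).1) (fun x => (hssC x).2) i w _ hw C2).1,
        (PecherAux.shift (fun x => (hssB x).1) (fun x => (hssD x).2) i w _ hw D2).1⟩))
    have hj0 : (j : ZMod n) - t = 0 := h2unit _ (hnoinv _ (Or.inr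
      ⟨(PecherAux.shift (fun x => (hssA x).2) (fun x => (hssC x).1) i w _ hw C1').1,
        (PecherAux.shift (fun x => (hssB x).2) (fun x => (hssD x).1) i w _ hw D1).1⟩))
    rw [hj0] at C1' D1
    rw [ht] at C2 D2
    simp only [sub_zero] at C1' C2 D1 D2
    have hpn : PecherAux.p n (n : ZMod (2 * n)) = 1 := by
      rw [map_natCast]; exact (ZMod.natCast_eq_one_iff_odd).2 hn
    have hqn : PecherAux.q n (n : ZMod (2 * n)) = 0 := by
      rw [map_natCast]; simp
    refine ⟨i', n, by exact_mod_cast hi'odd, ?_, ?_⟩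
    · have := PecherAux.image_iff n A' C' i' s n hs
        (PecherAux.eqv1 n A' C' i' s n hpn hqn hs C1' C2)
      simpa using this
    · have := PecherAux.image_iff n B' D' i' s (-n) hs
        (PecherAux.eqv1 n B' D' i' s (-n) (by rw [map_neg, hpn]; decide)
          (by rw [map_neg, hqn, neg_zero]) hs D1 D2)
      simpa [sub_eq_add_neg] using this
end
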